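/- arXiv:2601.10713 — 4 statements merged into one kernel-verified Lean document; each statement's English description precedes it below -/
import Mathlib

section
/- If a set E ⊆ {1,…,n} contains no stopping set of H, then the only vector v ∈ 𝔽₂ⁿ with supp(v) ⊆ E and Hv = 0 is v = 0; consequently, for every σ ∈ 𝔽₂^m there is at most one w ∈ 𝔽₂ⁿ with supp(w) ⊆ E and Hw = σ. -/
/-- Support of a vector over 𝔽₂, as a finset of coordinates. -/
def supp {n : ℕ} (v : Fin n → ZMod 2) : Finset (Fin n) :=
  Finset.univ.filter (fun j => v j ≠ 0)

/-- `S` is a stopping set of `H`: `S` is nonempty and every check with at least one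
neighbor in `S` has at least two neighbors in `S`. -/
def IsStoppingSet {m n : ℕ} (H : Matrix (Fin m) (Fin n) (ZMod 2)) (S : Finset (Fin n)) : Prop :=
  S.Nonempty ∧ ∀ i : Fin m,
    1 ≤ (S.filter (fun j => H i j = 1)).card → 2 ≤ (S.filter (fun j => H i j = 1)).card

/-- Check `i` is dangling for the erasure set `E`: exactly one `j ∈ E` has `H i j = 1`. -/
def Dangling {m n : ℕ} (H : Matrix (Fin m) (Fin n) (ZMod 2)) (E : Finset (Fin n))
    (i : Fin m) : Prop :=
  (E.filter (fun j => H i j = 1)).card = 1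

/-- A peel step: some check `i` is dangling for `E` with unique erased neighbor `j`,
which is removed from `E`. -/
def PeelStep {m n : ℕ} (H : Matrix (Fin m) (Fin n) (ZMod 2)) (E E' : Finset (Fin n)) : Prop :=
  ∃ i : Fin m, ∃ j ∈ E, E.filter (fun j' => H i j' = 1) = {j} ∧ E' = E.erase j

/-- A guess step: permitted only when no check is dangling for `E`; removes an
arbitrary single element of `E`. -/
def GuessStep {m n : ℕ} (H : Matrix (Fin m) (Fin n) (ZMod 2)) (E E' : Finset (Fin n)) : Prop :=
  (∀ i : Fin m, ¬ Dangling H E i) ∧ ∃ j ∈ E, E' = E.erase j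

/-- A Maxwell step is a peel step or a guess step. -/
def MaxwellStep {m n : ℕ} (H : Matrix (Fin m) (Fin n) (ZMod 2)) (E E' : Finset (Fin n)) : Prop :=
  PeelStep H E E' ∨ GuessStep H E E'

/-- A Maxwell trace from `E`: a finite sequence of peel/guess steps transforming `E`
into the empty set. -/
def IsMaxwellTrace {m n : ℕ} (H : Matrix (Fin m) (Fin n) (ZMod 2)) (E : Finset (Fin n))
    (k : ℕ) (f : Fin (k+1) → Finset (Fin n)) : Prop :=
  f 0 = E ∧ f (Fin.last k) = ∅ ∧ ∀ i : Fin k, MaxwellStep H (f i.castSucc) (f i.succ)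

/-- Number of guess steps in a trace: the steps starting from a state with no
dangling check (these are exactly the guess steps). -/
noncomputable def guessCount {m n : ℕ} (H : Matrix (Fin m) (Fin n) (ZMod 2)) {k : ℕ}
    (f : Fin (k+1) → Finset (Fin n)) : ℕ :=
  Nat.card {i : Fin k // ∀ c : Fin m, ¬ Dangling H (f i.castSucc) c}

/-- Over 𝔽₂, the syndrome bit of check `i` counts, modulo two, the neighbors of `i` in the
support. -/
lemma mulVec_apply_eq_card_filter_supp {m n : ℕ} (H : Matrix (Fin m) (Fin n) (ZMod 2))
    (v : Fin n → ZMod 2) (i : Fin m) :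
    H.mulVec v i = (((supp v).filter (fun j => H i j = 1)).card : ZMod 2) := by
  have mul_eq_ite : ∀ a b : ZMod 2, a * b = if b ≠ 0 ∧ a = 1 then 1 else 0 := by decide
  rw [supp, Finset.filter_filter, Finset.card_filter, Nat.cast_sum]
  simp only [Matrix.mulVec, dotProduct, mul_eq_ite, Nat.cast_ite, Nat.cast_one, Nat.cast_zero]

/-- The support of a nonzero vector in the kernel of `H` is a stopping set. -/
lemma isStoppingSet_supp {m n : ℕ} {H : Matrix (Fin m) (Fin n) (ZMod 2)}
    {v : Fin n → ZMod 2} (hv : v ≠ 0) (hHv : H.mulVec v = 0) : IsStoppingSet H (supp v) := by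
  refine ⟨?_, fun i hi => ?_⟩
  · obtain ⟨j, hj⟩ := Function.ne_iff.mp hv
    exact ⟨j, by simpa [supp] using hj⟩
  · have hcard := mulVec_apply_eq_card_filter_supp H v i
    rw [hHv, Pi.zero_apply, eq_comm, ZMod.natCast_eq_zero_iff] at hcard
    exact Nat.le_of_dvd hi hcard

/-- The support of a difference is contained in any set containing both supports. -/
lemma supp_sub_subset {n : ℕ} {w w' : Fin n → ZMod 2} {E : Finset (Fin n)}
    (hw : supp w ⊆ E) (hw' : supp w' ⊆ E) : supp (w - w') ⊆ E := by
  intro j hj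
  by_contra hjE
  have h : w j = 0 := by
    by_contra h
    exact hjE (hw (by simpa [supp] using h))
  have h' : w' j = 0 := by
    by_contra h'
    exact hjE (hw' (by simpa [supp] using h'))
  simp [supp, h, h'] at hj

/-- If `E` contains no stopping set of `H`, then the only vector supported
in `E` with zero syndrome is `0`; consequently, for each syndrome there is at most one
solution supported in `E`. -/
theorem no_stopping_set_implies_unique_solution {m n : ℕ}
    (H : Matrix (Fin m) (Fin n) (ZMod 2)) (E : Finset (Fin n))
    (hE : ∀ S : Finset (Fin n), S ⊆ E → ¬ IsStoppingSet H S) :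
    (∀ v : Fin n → ZMod 2, supp v ⊆ E → H.mulVec v = 0 → v = 0) ∧
    (∀ σ : Fin m → ZMod 2, ∀ w w' : Fin n → ZMod 2,
      supp w ⊆ E → supp w' ⊆ E → H.mulVec w = σ → H.mulVec w' = σ → w = w') := by
  have hker : ∀ v : Fin n → ZMod 2, supp v ⊆ E → H.mulVec v = 0 → v = 0 := by
    intro v hvE hHv
    by_contra hv
    exact hE _ hvE (isStoppingSet_supp hv hHv)
  refine ⟨hker, fun σ w w' hw hw' hσ hσ' => sub_eq_zero.mp ?_⟩
  exact hker _ (supp_sub_subset hw hw') (by rw [Matrix.mulVec_sub, hσ, hσ', sub_self])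
end

section
/- Let E ⊆ {1,…,n}, σ ∈ 𝔽₂^m, and suppose check i is dangling for E, with j the unique element of E such that H_{i,j} = 1. Let e_j ∈ 𝔽₂ⁿ be the j-th standard basis vector. Then the map u ↦ u + σ_i·e_j is a bijection from {u ∈ 𝔽₂ⁿ : supp(u) ⊆ E∖{j} and Hu = σ + σ_i·(H e_j)} onto {w ∈ 𝔽₂ⁿ : supp(w) ⊆ E and Hw = σ}. -/
theorem notMem_supp {n : ℕ} {v : Fin n → ZMod 2} {j : Fin n} : j ∉ supp v ↔ v j = 0 := by
  simp [supp]

theorem supp_subset_iff {n : ℕ} {v : Fin n → ZMod 2} {E : Finset (Fin n)} :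
    supp v ⊆ E ↔ ∀ j ∉ E, v j = 0 := by
  simp only [Finset.subset_iff, ← notMem_supp]
  exact forall_congr' fun _ => not_imp_not.symm

/-- If `j` is the only element of `E` adjacent to the check `i`, then the `i`-th syndrome bit of a
vector supported in `E` is its `j`-th coordinate. -/
theorem mulVec_apply_of_filter_eq_singleton {m n : ℕ} {H : Matrix (Fin m) (Fin n) (ZMod 2)}
    {E : Finset (Fin n)} {i : Fin m} {j : Fin n} (hj : E.filter (fun j' => H i j' = 1) = {j})
    {w : Fin n → ZMod 2} (hw : supp w ⊆ E) : H.mulVec w i = w j := by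
  have hmem : j ∈ E.filter (fun j' => H i j' = 1) := hj ▸ Finset.mem_singleton_self j
  have hjE : H i j = 1 := (Finset.mem_filter.mp hmem).2
  rw [Matrix.mulVec, dotProduct, Finset.sum_eq_single j, hjE, one_mul]
  · intro k _ hkj
    by_cases hk : k ∈ E
    · have hne : H i k ≠ 1 := fun h =>
        hkj (Finset.mem_singleton.mp (hj ▸ Finset.mem_filter.mpr ⟨hk, h⟩))
      have h0 : ∀ a : ZMod 2, a ≠ 1 → a = 0 := by decide
      rw [h0 _ hne, zero_mul]
    · rw [supp_subset_iff.mp hw k hk, mul_zero]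
  · simp

/-- With check `i` dangling for `E` and `j` its unique erased neighbor,
the map `u ↦ u + σ_i • e_j` is a bijection from the solutions supported in `E \ {j}`
with syndrome `σ + σ_i • (H e_j)` onto the solutions supported in `E` with syndrome `σ`. -/
theorem peel_step_solution_bijection {m n : ℕ}
    (H : Matrix (Fin m) (Fin n) (ZMod 2)) (E : Finset (Fin n)) (σ : Fin m → ZMod 2)
    (i : Fin m) (j : Fin n) (hj : E.filter (fun j' => H i j' = 1) = {j}) :
    Set.BijOn (fun u : Fin n → ZMod 2 => u + σ i • (Pi.single j 1 : Fin n → ZMod 2))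
      {u : Fin n → ZMod 2 | supp u ⊆ E.erase j ∧
        H.mulVec u = σ + σ i • H.mulVec (Pi.single j 1 : Fin n → ZMod 2)}
      {w : Fin n → ZMod 2 | supp w ⊆ E ∧ H.mulVec w = σ} := by
  have hmem : j ∈ E.filter (fun j' => H i j' = 1) := hj ▸ Finset.mem_singleton_self j
  have hjE : j ∈ E := (Finset.mem_filter.mp hmem).1
  have add_self : ∀ a : ZMod 2, a + a = 0 := by decide
  have add_self' : ∀ {k : ℕ} (v : Fin k → ZMod 2), v + v = 0 := fun v =>
    funext fun l => add_self (v l)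
  refine ⟨?_, fun u _ v _ h => add_right_cancel h, ?_⟩
  · rintro u ⟨hu, hHu⟩
    refine ⟨supp_subset_iff.mpr fun k hk => ?_, ?_⟩
    · have hkj : k ≠ j := fun h => hk (h ▸ hjE)
      have huk : u k = 0 := supp_subset_iff.mp hu k fun h => hk (Finset.mem_of_mem_erase h)
      simp [huk, hkj]
    · rw [Matrix.mulVec_add, Matrix.mulVec_smul, hHu, add_assoc, add_self', add_zero]
  · rintro w ⟨hw, hHw⟩
    have hwj : w j = σ i := by rw [← mulVec_apply_of_filter_eq_singleton hj hw, hHw]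
    refine ⟨w + σ i • (Pi.single j 1 : Fin n → ZMod 2),
      ⟨supp_subset_iff.mpr fun k hk => ?_, ?_⟩, ?_⟩
    · by_cases hkj : k = j
      · subst hkj
        simp [hwj, add_self]
      · have hwk : w k = 0 :=
          supp_subset_iff.mp hw k fun h => hk (Finset.mem_erase.mpr ⟨hkj, h⟩)
        simp [hwk, hkj]
    · rw [Matrix.mulVec_add, Matrix.mulVec_smul, hHw]
    · simp only [add_assoc, add_self', add_zero]
end

section
/- Let S be a stopping set of the CSS code with |S| ≤ t, and suppose S does not contain the support of any NTLO. Then A^SS(|S|) > A^NTLO(|S|); that is, |S| ∈ W_0(t). -/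
/-- Row space of `H`: the 𝔽₂-span of the rows of `H` in 𝔽₂ⁿ. -/
def rowSpace {m n : ℕ} (H : Matrix (Fin m) (Fin n) (ZMod 2)) :
    Submodule (ZMod 2) (Fin n → ZMod 2) :=
  Submodule.span (ZMod 2) (Set.range fun i => H i)

/-- Nontrivial logical operator of the CSS code `(HX, HZ)`. -/
def IsNTLO {mX mZ n : ℕ} (HX : Matrix (Fin mX) (Fin n) (ZMod 2))
    (HZ : Matrix (Fin mZ) (Fin n) (ZMod 2)) (v : Fin n → ZMod 2) : Prop :=
  v ≠ 0 ∧ ((HZ.mulVec v = 0 ∧ v ∉ rowSpace HX) ∨ (HX.mulVec v = 0 ∧ v ∉ rowSpace HZ))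

/-- A stopping set of the CSS code: a stopping set of `HX` or of `HZ`. -/
def IsCSSStoppingSet {mX mZ n : ℕ} (HX : Matrix (Fin mX) (Fin n) (ZMod 2))
    (HZ : Matrix (Fin mZ) (Fin n) (ZMod 2)) (S : Finset (Fin n)) : Prop :=
  IsStoppingSet HX S ∨ IsStoppingSet HZ S

/-- `ASS w`: number of `w`-element subsets of coordinates that are stopping sets
of the CSS code. -/
noncomputable def ASS {mX mZ n : ℕ} (HX : Matrix (Fin mX) (Fin n) (ZMod 2))
    (HZ : Matrix (Fin mZ) (Fin n) (ZMod 2)) (w : ℕ) : ℕ :=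
  Nat.card {S : Finset (Fin n) // S.card = w ∧ IsCSSStoppingSet HX HZ S}

/-- `ANTLO w`: number of `w`-element subsets of coordinates that are the support of
some nontrivial logical operator. -/
noncomputable def ANTLO {mX mZ n : ℕ} (HX : Matrix (Fin mX) (Fin n) (ZMod 2))
    (HZ : Matrix (Fin mZ) (Fin n) (ZMod 2)) (w : ℕ) : ℕ :=
  Nat.card {S : Finset (Fin n) // S.card = w ∧ ∃ v, IsNTLO HX HZ v ∧ supp v = S}

/-- `W0 t = {w : 0 < w ≤ t and ASS w > ANTLO w}`. -/
noncomputable def W0 {mX mZ n : ℕ} (HX : Matrix (Fin mX) (Fin n) (ZMod 2))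
    (HZ : Matrix (Fin mZ) (Fin n) (ZMod 2)) (t : ℕ) : Finset ℕ :=
  (Finset.range (t+1)).filter (fun w => 0 < w ∧ ANTLO HX HZ w < ASS HX HZ w)

/-- The distribution gap `γ(t) = |W0(t)|`. -/
noncomputable def gam {mX mZ n : ℕ} (HX : Matrix (Fin mX) (Fin n) (ZMod 2))
    (HZ : Matrix (Fin mZ) (Fin n) (ZMod 2)) (t : ℕ) : ℕ :=
  (W0 HX HZ t).card

/-- `F_ML`: erasure sets containing the support of some NTLO. -/
def FML {mX mZ n : ℕ} (HX : Matrix (Fin mX) (Fin n) (ZMod 2))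
    (HZ : Matrix (Fin mZ) (Fin n) (ZMod 2)) : Set (Finset (Fin n)) :=
  {E | ∃ v, IsNTLO HX HZ v ∧ supp v ⊆ E}

/-- `F_QM(G)`: erasure sets admitting some Maxwell trace (with respect to `HZ` or to
`HX`) with more than `G` guess steps. -/
def FQM {mX mZ n : ℕ} (HX : Matrix (Fin mX) (Fin n) (ZMod 2))
    (HZ : Matrix (Fin mZ) (Fin n) (ZMod 2)) (G : ℕ) : Set (Finset (Fin n)) :=
  {E | (∃ (k : ℕ) (f : Fin (k+1) → Finset (Fin n)),
          IsMaxwellTrace HZ E k f ∧ G < guessCount HZ f) ∨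
       (∃ (k : ℕ) (f : Fin (k+1) → Finset (Fin n)),
          IsMaxwellTrace HX E k f ∧ G < guessCount HX f)}

open Classical in
/-- `P_F(ε) = Σ_{E ∈ F} ε^{|E|} (1-ε)^{n-|E|}`. -/
noncomputable def Pfail (n : ℕ) (F : Set (Finset (Fin n))) (ε : ℝ) : ℝ :=
  ∑ E ∈ Finset.univ.filter (fun E : Finset (Fin n) => E ∈ F),
    ε ^ E.card * (1 - ε) ^ (n - E.card)

/-- The support of a nonzero vector in the kernel of `H` is a stopping set of `H`. -/
theorem isStoppingSet_supp_of_mulVec_eq_zero {m n : ℕ} (H : Matrix (Fin m) (Fin n) (ZMod 2))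
    {v : Fin n → ZMod 2} (hv : v ≠ 0) (h : H.mulVec v = 0) : IsStoppingSet H (supp v) := by
  refine ⟨?_, fun i hi => ?_⟩
  · obtain ⟨j, hj⟩ := Function.ne_iff.mp hv
    exact ⟨j, by simpa [supp] using hj⟩
  · have hsum : (((supp v).filter (fun j => H i j = 1)).card : ZMod 2) = 0 := by
      have hrow : ∑ j, H i j * v j = 0 := congrFun h i
      rw [Finset.card_filter, supp, Finset.sum_filter]
      push_cast
      refine (Finset.sum_congr rfl fun j _ => ?_).trans hrow
      have key : ∀ a b : ZMod 2, (if b ≠ 0 then (if a = 1 then (1 : ZMod 2) else 0) else 0) =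
          a * b := by decide
      simpa using key (H i j) (v j)
    have hdvd : 2 ∣ ((supp v).filter (fun j => H i j = 1)).card :=
      (ZMod.natCast_eq_zero_iff _ 2).mp hsum
    exact Nat.le_of_dvd hi hdvd

/-- The support of a nontrivial logical operator is a stopping set of the CSS code. -/
theorem IsNTLO.isCSSStoppingSet_supp {mX mZ n : ℕ} {HX : Matrix (Fin mX) (Fin n) (ZMod 2)}
    {HZ : Matrix (Fin mZ) (Fin n) (ZMod 2)} {v : Fin n → ZMod 2} (hv : IsNTLO HX HZ v) :
    IsCSSStoppingSet HX HZ (supp v) := by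
  obtain ⟨hne, ⟨hZ, _⟩ | ⟨hX, _⟩⟩ := hv
  · exact Or.inr (isStoppingSet_supp_of_mulVec_eq_zero HZ hne hZ)
  · exact Or.inl (isStoppingSet_supp_of_mulVec_eq_zero HX hne hX)

/-- If `S` is a stopping set of the CSS code with `|S| ≤ t` that does not
contain the support of any NTLO, then `ASS |S| > ANTLO |S|`, i.e. `|S| ∈ W0 t`. -/
theorem stopping_set_without_ntlo_in_gap {mX mZ n : ℕ}
    (HX : Matrix (Fin mX) (Fin n) (ZMod 2)) (HZ : Matrix (Fin mZ) (Fin n) (ZMod 2))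
    (hCSS : HX * HZ.transpose = 0) (t : ℕ) (ht : t ≤ n) (S : Finset (Fin n))
    (hS : IsCSSStoppingSet HX HZ S) (hcard : S.card ≤ t)
    (hno : ∀ v : Fin n → ZMod 2, IsNTLO HX HZ v → ¬ supp v ⊆ S) :
    ANTLO HX HZ S.card < ASS HX HZ S.card ∧ S.card ∈ W0 HX HZ t := by
  have hlt : ANTLO HX HZ S.card < ASS HX HZ S.card := by
    refine Set.ncard_lt_ncard (s := {T | T.card = S.card ∧ ∃ v, IsNTLO HX HZ v ∧ supp v = T})
      (t := {T | T.card = S.card ∧ IsCSSStoppingSet HX HZ T}) ?_ (Set.toFinite _)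
    refine (Set.ssubset_iff_of_subset ?_).mpr ⟨S, ⟨rfl, hS⟩, ?_⟩
    · rintro _ ⟨hT, v, hv, rfl⟩
      exact ⟨hT, hv.isCSSStoppingSet_supp⟩
    · rintro ⟨_, v, hv, hvS⟩
      exact hno v hv hvS.subset
  have hpos : 0 < S.card := Finset.card_pos.mpr (hS.elim And.left And.left)
  exact ⟨hlt, Finset.mem_filter.mpr ⟨Finset.mem_range.mpr (Nat.lt_succ_of_le hcard), hpos, hlt⟩⟩
end

section
/- Assume the CSS code admits at least one NTLO, and let d be the minimum Hamming weight of an NTLO. Then for all ε ∈ (0, 1/2], 2^{−n} · ε^d ≤ p_L^ML(ε) ≤ 2ⁿ · ε^d. -/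
/-- A single member of `F` bounds `Pfail n F ε` from below. -/
theorem le_Pfail_of_mem {n : ℕ} {F : Set (Finset (Fin n))} {E : Finset (Fin n)} (hE : E ∈ F)
    {ε : ℝ} (h0 : 0 ≤ ε) (h1 : ε ≤ 1) :
    ε ^ E.card * (1 - ε) ^ (n - E.card) ≤ Pfail n F ε := by
  classical
  have h1' : 0 ≤ 1 - ε := sub_nonneg.2 h1
  unfold Pfail
  exact Finset.single_le_sum
    (f := fun E : Finset (Fin n) => ε ^ E.card * (1 - ε) ^ (n - E.card))
    (fun _ _ => by positivity) (by simpa using hE)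

/-- If every member of `F` has at least `d` elements, then `Pfail n F ε ≤ 2 ^ n * ε ^ d`. -/
theorem Pfail_le_of_forall_le_card {n d : ℕ} {F : Set (Finset (Fin n))}
    (hF : ∀ E ∈ F, d ≤ E.card) {ε : ℝ} (h0 : 0 ≤ ε) (h1 : ε ≤ 1) :
    Pfail n F ε ≤ 2 ^ n * ε ^ d := by
  classical
  have hterm : ∀ E ∈ Finset.univ.filter (fun E : Finset (Fin n) => E ∈ F),
      ε ^ E.card * (1 - ε) ^ (n - E.card) ≤ ε ^ d := fun E hE =>
    (mul_le_of_le_one_right (by positivity)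
      (pow_le_one₀ (sub_nonneg.2 h1) (sub_le_self _ h0))).trans
      (pow_le_pow_of_le_one h0 h1 (hF E (by simpa using hE)))
  have hcard : ((Finset.univ.filter (fun E : Finset (Fin n) => E ∈ F)).card : ℝ) ≤ 2 ^ n := by
    have h := Finset.card_filter_le (Finset.univ : Finset (Finset (Fin n))) (fun E => E ∈ F)
    rw [Finset.card_univ, Fintype.card_finset, Fintype.card_fin] at h
    exact_mod_cast h
  unfold Pfail
  calc _ ≤ _ := Finset.sum_le_card_nsmul _ _ _ hterm
    _ ≤ 2 ^ n * ε ^ d := by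
      rw [nsmul_eq_mul]
      exact mul_le_mul_of_nonneg_right (by convert hcard) (by positivity)

/-- If the CSS code admits an NTLO of minimum weight `d`, then for all
`ε ∈ (0, 1/2]`, `2^{-n} ε^d ≤ p_L^ML(ε) ≤ 2^n ε^d`. -/
theorem pML_epsilon_d_bounds {mX mZ n : ℕ}
    (HX : Matrix (Fin mX) (Fin n) (ZMod 2)) (HZ : Matrix (Fin mZ) (Fin n) (ZMod 2))
    (hCSS : HX * HZ.transpose = 0) (d : ℕ)
    (hd : IsLeast {w : ℕ | ∃ v, IsNTLO HX HZ v ∧ (supp v).card = w} d) :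
    ∀ ε : ℝ, ε ∈ Set.Ioc (0 : ℝ) (1/2) →
      ε ^ d / 2 ^ n ≤ Pfail n (FML HX HZ) ε ∧
      Pfail n (FML HX HZ) ε ≤ 2 ^ n * ε ^ d := by
  rintro ε ⟨hpos, hhalf⟩
  have h1 : ε ≤ 1 := hhalf.trans (by norm_num)
  obtain ⟨⟨v, hv, hvd⟩, hmin⟩ := hd
  refine ⟨?_, Pfail_le_of_forall_le_card ?_ hpos.le h1⟩
  · have h := le_Pfail_of_mem (F := FML HX HZ) ⟨v, hv, subset_rfl⟩ hpos.le h1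
    rw [hvd] at h
    refine le_trans ?_ h
    rw [div_eq_mul_inv, ← inv_pow]
    gcongr
    calc ((2 : ℝ)⁻¹) ^ n ≤ 2⁻¹ ^ (n - d) :=
          pow_le_pow_of_le_one (by norm_num) (by norm_num) (Nat.sub_le n d)
      _ ≤ (1 - ε) ^ (n - d) := by
          gcongr
          linarith
  · rintro E ⟨w, hw, hwE⟩
    exact (hmin ⟨w, hw, rfl⟩).trans (Finset.card_le_card hwE)
end
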